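/- Let F(X,Y,Z) = 4X³Y − 3X²Y² + 3XY³ − X³Z + 16X²YZ − 11XY²Z + 5Y³Z + 3X²Z² + 9XYZ² + Y²Z² + XZ³ + 2YZ³ ∈ ℚ[X,Y,Z]. Then the projective plane curve F = 0 is smooth: for any algebraically closed field k of characteristic zero (for instance k = ℂ), the only common zero in k³ of F and its three partial derivatives ∂F/∂X, ∂F/∂Y, ∂F/∂Z is (0, 0, 0). -/

import Mathlib

open MvPolynomial

/-- The homogeneous quartic `F(X,Y,Z)` defining the canonical model of `X_{S₄}(13)` in `ℙ²`,
as a multivariate polynomial in the variables `X 0 = X`, `X 1 = Y`, `X 2 = Z`. -/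
noncomputable def quarticFmv : MvPolynomial (Fin 3) ℚ :=
  4 * X 0 ^ 3 * X 1 - 3 * X 0 ^ 2 * X 1 ^ 2 + 3 * X 0 * X 1 ^ 3 - X 0 ^ 3 * X 2
    + 16 * X 0 ^ 2 * X 1 * X 2 - 11 * X 0 * X 1 ^ 2 * X 2 + 5 * X 1 ^ 3 * X 2
    + 3 * X 0 ^ 2 * X 2 ^ 2 + 9 * X 0 * X 1 * X 2 ^ 2 + X 1 ^ 2 * X 2 ^ 2
    + X 0 * X 2 ^ 3 + 2 * X 1 * X 2 ^ 3

/-- The three partial derivatives of `F` have no common zero other than the origin, in any field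
of characteristic zero. -/
theorem eq_zero_of_quarticF_partials_eq_zero {k : Type*} [Field k] [CharZero k] {x y z : k}
    (h0 : 12 * x ^ 2 * y - 3 * x ^ 2 * z - 6 * x * y ^ 2 + 32 * x * y * z + 6 * x * z ^ 2
      + 3 * y ^ 3 - 11 * y ^ 2 * z + 9 * y * z ^ 2 + z ^ 3 = 0)
    (h1 : 4 * x ^ 3 - 6 * x ^ 2 * y + 16 * x ^ 2 * z + 9 * x * y ^ 2 - 22 * x * y * z + 9 * x * z ^ 2
      + 15 * y ^ 2 * z + 2 * y * z ^ 2 + 2 * z ^ 3 = 0)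
    (h2 : -x ^ 3 + 16 * x ^ 2 * y + 6 * x ^ 2 * z - 11 * x * y ^ 2 + 18 * x * y * z + 3 * x * z ^ 2
      + 5 * y ^ 3 + 2 * y ^ 2 * z + 6 * y * z ^ 2 = 0) :
    x = 0 ∧ y = 0 ∧ z = 0 := by
  have hx : x = 0 := by
    have h : 4464304 * x ^ 7 = 0 := by
      linear_combination
        (2374046 * x ^ 4 - 202196 * x ^ 3 * y + 1298316 * x ^ 3 * z + 62582 * x ^ 2 * y ^ 2
            + 1365064 * x ^ 2 * y * z + 227166 * x ^ 2 * z ^ 2 + 1249098 * x * y ^ 3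
            + 40060 * x * y ^ 2 * z + 156292 * x * y * z ^ 2 - 506880 * y ^ 4
            - 155232 * y ^ 3 * z) * h0
        + (857429 * x ^ 4 - 1847020 * x ^ 3 * y - 427614 * x ^ 3 * z - 1052893 * x ^ 2 * y ^ 2
            - 924578 * x ^ 2 * y * z - 113583 * x ^ 2 * z ^ 2 + 1076623 * x * y ^ 3
            - 645198 * x * y ^ 2 * z - 78146 * x * y * z ^ 2 - 538164 * y ^ 4
            + 77616 * y ^ 3 * z) * h1
        + (-1034588 * x ^ 4 - 597510 * x ^ 3 * y - 1321258 * x ^ 3 * z - 262911 * x ^ 2 * y ^ 2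
            - 740306 * x ^ 2 * y * z - 261279 * x ^ 2 * z ^ 2 + 280062 * x * y ^ 3
            - 126795 * x * y ^ 2 * z + 304128 * y ^ 4 + 470844 * y ^ 3 * z) * h2
    simpa using h
  subst hx
  have hy : y = 0 := by
    have h : 15457 * y ^ 4 = 0 := by
      linear_combination
        (-1156 * y + 508 * z) * h0
        + (-1454 * y - 254 * z) * h1
        + 3785 * y * h2
    simpa using h
  subst hy
  have hz : z = 0 := by simpa using h0
  exact ⟨rfl, rfl, hz⟩

/-- The plane quartic `F = 0` is smooth: over any algebraically closed field `k` of
characteristic zero, the only common zero in `k³` of `F` and its three partial derivatives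
is `(0, 0, 0)`. -/
theorem quarticF_smooth (k : Type*) [Field k] [IsAlgClosed k] [CharZero k] (x y z : k)
    (hF : aeval ![x, y, z] quarticFmv = 0)
    (hD : ∀ i : Fin 3, aeval ![x, y, z] (pderiv i quarticFmv) = 0) :
    x = 0 ∧ y = 0 ∧ z = 0 := by
  have pderiv_ofNat (i : Fin 3) (n : ℕ) [n.AtLeastTwo] :
      pderiv i (OfNat.ofNat n : MvPolynomial (Fin 3) ℚ) = 0 :=
    (pderiv i).map_natCast n
  have h0 := hD 0
  have h1 := hD 1
  have h2 := hD 2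
  simp [quarticFmv, pderiv_ofNat, pderiv_X, Derivation.leibniz, Derivation.leibniz_pow] at h0 h1 h2
  refine eq_zero_of_quarticF_partials_eq_zero ?_ ?_ ?_
  · linear_combination h0
  · linear_combination h1
  · linear_combination h2
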